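/- arXiv:1708.02783 — 2 statements merged into one kernel-verified Lean document; each statement's English description precedes it below -/
import Mathlib

section
/- For every w = (w_1, …, w_n) ∈ 𝒮_n, there is an isomorphism of chain complexes ⟦w_1, w_2, …, w_n⟧ ≅ ⟦w_2, …, w_n, w_1⟧_{2w_1−n−1}, i.e. the complex for the cyclically shifted weight, with degrees shifted by 2w_1 − n − 1. -/
namespace Nil

/-- Index pairs `(a,b)` with `a < b` in `Fin n`, indexing the basis `e_{ab}` of `nil_n`. -/
abbrev P (n : ℕ) : Type := {p : Fin n × Fin n // p.1 < p.2}

/-- Lexicographic key of a pair. -/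
def key {n : ℕ} (p : P n) : ℕ := p.1.1.1 * n + p.1.2.1

/-- Position (0-based) of `a` in the lexicographically sorted list of `M`. -/
def pos {n : ℕ} (M : Finset (P n)) (a : P n) : ℕ :=
  (M.filter fun b => key b < key a).card

/-- Basis of the degree `k` part of the Chevalley-Eilenberg complex `Λ^* nil_n`:
subsets `M` of pairs with `|M| = k` (empty for `k < 0`). -/
abbrev B (n : ℕ) (k : ℤ) : Type := {M : Finset (P n) // (M.card : ℤ) = k}

/-- Degree `k` chain group of the Chevalley-Eilenberg complex of `nil_n`. -/
abbrev C (n : ℕ) (k : ℤ) : Type := B n k →₀ ℤ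

/-- The Chevalley-Eilenberg boundary of a basis wedge `e_M`:
`∂(e_{a₁b₁} ∧ … ∧ e_{aₖbₖ}) = Σ_{i<j} (-1)^{i+j} [e_{aᵢbᵢ}, e_{aⱼbⱼ}] ∧ …` (omitting
the i-th and j-th factors), written in the lexicographically sorted basis.
For lexicographically sorted wedges the only nonzero brackets come from pairs
`a = (x,y)`, `b = (y,z)`, producing `±e_{(x,z)}`. -/
noncomputable def dAux {n : ℕ} (k : ℤ) (M : Finset (P n)) : C n k :=
  ∑ a ∈ M, ∑ b ∈ M,
    if hab : a.1.2 = b.1.1 then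
      (let c : P n := ⟨(a.1.1, b.1.2), lt_trans a.2 (by rw [hab]; exact b.2)⟩
       let M' : Finset (P n) := insert c ((M.erase a).erase b)
       if h' : (M'.card : ℤ) = k then
         ((-1 : ℤ) ^ (pos M a + pos M b + pos M' c)) • Finsupp.single (⟨M', h'⟩ : B n k) 1
       else 0)
    else 0

/-- The Chevalley-Eilenberg boundary map in degree `k+1`. -/
noncomputable def d (n : ℕ) (k : ℤ) : C n (k + 1) →ₗ[ℤ] C n k :=
  Finsupp.lsum ℤ fun M => LinearMap.toSpanSingleton ℤ (C n k) (dAux k M.1)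

/-- Degree-cast isomorphism. -/
noncomputable def castC (n : ℕ) {k l : ℤ} (h : k = l) : C n k ≃ₗ[ℤ] C n l :=
  Finsupp.domLCongr (Equiv.subtypeEquivRight fun _ => by rw [h])

/-- The boundary map out of degree `k`. -/
noncomputable def dFrom (n : ℕ) (k : ℤ) : C n k →ₗ[ℤ] C n (k - 1) :=
  (d n (k - 1)).comp (castC n (by ring : k = k - 1 + 1)).toLinearMap

/-- Cycles of `Λ^* nil_n` in degree `k`. -/
noncomputable def Zfull (n : ℕ) (k : ℤ) : Submodule ℤ (C n k) := LinearMap.ker (dFrom n k)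

noncomputable def HnilSub (n : ℕ) (k : ℤ) : Submodule ℤ (Zfull n k) :=
  Submodule.comap (Zfull n k).subtype (LinearMap.range (d n k) ⊓ Zfull n k)

/-- `H_k(nil_n; ℤ)`: the `k`-th integral homology of the Chevalley-Eilenberg complex
of the Lie ring of strictly upper triangular `n × n` integer matrices. -/
noncomputable def Hnil (n : ℕ) (k : ℤ) : Type := Zfull n k ⧸ HnilSub n k

noncomputable instance (n : ℕ) (k : ℤ) : AddCommGroup (Hnil n k) :=
  inferInstanceAs (AddCommGroup (Zfull n k ⧸ HnilSub n k))

noncomputable instance (n : ℕ) (k : ℤ) : Module ℤ (Hnil n k) :=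
  inferInstanceAs (Module ℤ (Zfull n k ⧸ HnilSub n k))

/-- The modified weight of a basis wedge `e_M` (indices of `Fin n` are 0-based, so the
`i`-th weight of the paper, `1 ≤ i ≤ n`, is `wt M ⟨i-1,_⟩`):
`w_i(e_M) = i - #{x : (x,i) ∈ M} + #{y : (i,y) ∈ M}`. -/
def wt {n : ℕ} (M : Finset (P n)) : Fin n → ℤ := fun i =>
  ((i.1 : ℤ) + 1) - (M.filter fun p => p.1.2 = i).card + (M.filter fun p => p.1.1 = i).card

/-- Basis wedges of degree `k` and modified weight `w`. -/
abbrev Bw (n : ℕ) (k : ℤ) (w : Fin n → ℤ) : Type :=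
  {M : Finset (P n) // (M.card : ℤ) = k ∧ wt M = w}

/-- Degree `k` part of the weight summand `⟦w⟧` of `Λ^* nil_n`. -/
abbrev Cw (n : ℕ) (k : ℤ) (w : Fin n → ℤ) : Type := Bw n k w →₀ ℤ

/-- Inclusion of the weight summand. -/
noncomputable def inclW (n : ℕ) (k : ℤ) (w : Fin n → ℤ) : Cw n k w →ₗ[ℤ] C n k :=
  Finsupp.lmapDomain ℤ ℤ fun M => (⟨M.1, M.2.1⟩ : B n k)

/-- Projection onto the weight summand. -/
noncomputable def projW (n : ℕ) (k : ℤ) (w : Fin n → ℤ) : C n k →ₗ[ℤ] Cw n k w :=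
  Finsupp.lsum ℤ fun M =>
    if h : wt M.1 = w then
      LinearMap.toSpanSingleton ℤ (Cw n k w) (Finsupp.single (⟨M.1, M.2, h⟩ : Bw n k w) 1)
    else 0

/-- The boundary of the weight summand `⟦w⟧` (the boundary preserves weights, so this
is the restriction of the Chevalley-Eilenberg boundary). -/
noncomputable def dW (n : ℕ) (k : ℤ) (w : Fin n → ℤ) : Cw n (k + 1) w →ₗ[ℤ] Cw n k w :=
  (projW n k w) ∘ₗ (d n k) ∘ₗ (inclW n (k + 1) w)

noncomputable def castCw (n : ℕ) (w : Fin n → ℤ) {k l : ℤ} (h : k = l) :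
    Cw n k w ≃ₗ[ℤ] Cw n l w :=
  Finsupp.domLCongr (Equiv.subtypeEquivRight fun _ => by rw [h])

noncomputable def dFromW (n : ℕ) (k : ℤ) (w : Fin n → ℤ) : Cw n k w →ₗ[ℤ] Cw n (k - 1) w :=
  (dW n (k - 1) w).comp (castCw n w (by ring : k = k - 1 + 1)).toLinearMap

noncomputable def ZW (n : ℕ) (k : ℤ) (w : Fin n → ℤ) : Submodule ℤ (Cw n k w) :=
  LinearMap.ker (dFromW n k w)

noncomputable def HwSub (n : ℕ) (k : ℤ) (w : Fin n → ℤ) : Submodule ℤ (ZW n k w) :=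
  Submodule.comap (ZW n k w).subtype (LinearMap.range (dW n k w) ⊓ ZW n k w)

/-- `H_k⟦w⟧`: the `k`-th homology of the weight summand `⟦w⟧` of `Λ^* nil_n`. -/
noncomputable def Hw (n : ℕ) (k : ℤ) (w : Fin n → ℤ) : Type := ZW n k w ⧸ HwSub n k w

noncomputable instance (n : ℕ) (k : ℤ) (w : Fin n → ℤ) : AddCommGroup (Hw n k w) :=
  inferInstanceAs (AddCommGroup (ZW n k w ⧸ HwSub n k w))

noncomputable instance (n : ℕ) (k : ℤ) (w : Fin n → ℤ) : Module ℤ (Hw n k w) :=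
  inferInstanceAs (Module ℤ (ZW n k w ⧸ HwSub n k w))

/-- `w ∈ 𝒮_n`: all entries lie in `{1,…,n}` and they add up to `binom (n+1) 2`. -/
def Sn (n : ℕ) (w : Fin n → ℤ) : Prop :=
  (∀ i, 1 ≤ w i ∧ w i ≤ (n : ℤ)) ∧ 2 * ∑ i, w i = (n : ℤ) * ((n : ℤ) + 1)

/-- Number of inversions of a permutation of `Fin n`. -/
def invCount (n : ℕ) (π : Equiv.Perm (Fin n)) : ℕ :=
  (Finset.univ.filter fun p : Fin n × Fin n => p.1 < p.2 ∧ π p.2 < π p.1).card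

/-- The weight sequence `(π(1), …, π(n))` attached to a permutation (1-based values). -/
def permWt (n : ℕ) (π : Equiv.Perm (Fin n)) : Fin n → ℤ := fun i => ((π i).1 : ℤ) + 1

/-- The set of inversions of a permutation, as a set of index pairs. -/
def invFinset {n : ℕ} (π : Equiv.Perm (Fin n)) : Finset (P n) :=
  Finset.univ.filter fun p => π p.1.2 < π p.1.1

/-- Index reversal `i ↦ n+1-i` (0-based: `i ↦ n-1-i`). -/
def rev {n : ℕ} (i : Fin n) : Fin n := ⟨n - 1 - i.1, by have := i.isLt; omega⟩


/-- The cyclic shift `(w₁, …, w_n) ↦ (w₂, …, w_n, w₁)` of a weight sequence. -/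
def cyc {n : ℕ} (w : Fin n → ℤ) : Fin n → ℤ := fun i => w ⟨(i.1 + 1) % n, Nat.mod_lt _ i.pos⟩

/-- The bijection of index pairs underlying the cyclic shift: `(0, y) ↦ (y - 1, n - 1)` and
`(x, y) ↦ (x - 1, y - 1)` for `0 < x`. -/
def shiftPair {n : ℕ} : P n ≃ P n where
  toFun p :=
    if h : p.1.1.1 = 0 then
      ⟨(⟨p.1.2.1 - 1, by omega⟩, ⟨n - 1, by omega⟩), by
        have := p.2; have := p.1.2.2; simp only [Fin.lt_def] at *; omega⟩
    else
      ⟨(⟨p.1.1.1 - 1, by omega⟩, ⟨p.1.2.1 - 1, by omega⟩), by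
        have := p.2; simp only [Fin.lt_def] at *; omega⟩
  invFun q :=
    if h : q.1.2.1 = n - 1 then
      ⟨(⟨0, by omega⟩, ⟨q.1.1.1 + 1, by
        have := q.2; have := q.1.2.2; simp only [Fin.lt_def] at *; omega⟩), by
        simp only [Fin.lt_def]; omega⟩
    else
      ⟨(⟨q.1.1.1 + 1, by have := q.2; simp only [Fin.lt_def] at *; omega⟩,
        ⟨q.1.2.1 + 1, by omega⟩), by
        have := q.2; simp only [Fin.lt_def] at *; omega⟩
  left_inv := by
    rintro ⟨⟨⟨x, hx⟩, ⟨y, hy⟩⟩, h⟩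
    simp only [Fin.lt_def] at h
    by_cases h0 : x = 0
    · subst h0
      simp
      omega
    · have : y - 1 ≠ n - 1 := by omega
      simp [h0, this]
      omega
  right_inv := by
    rintro ⟨⟨⟨x, hx⟩, ⟨y, hy⟩⟩, h⟩
    simp only [Fin.lt_def] at h
    by_cases h0 : y = n - 1
    · simp [h0]
    · simp [h0]

theorem shiftPair_fst {n : ℕ} (p : P n) :
    (shiftPair p).1.1.1 = if p.1.1.1 = 0 then p.1.2.1 - 1 else p.1.1.1 - 1 := by
  simp only [shiftPair, Equiv.coe_fn_mk]
  split_ifs <;> rfl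

theorem shiftPair_snd {n : ℕ} (p : P n) :
    (shiftPair p).1.2.1 = if p.1.1.1 = 0 then n - 1 else p.1.2.1 - 1 := by
  simp only [shiftPair, Equiv.coe_fn_mk]
  split_ifs <;> rfl

theorem P.lt {n : ℕ} (p : P n) : p.1.1.1 < p.1.2.1 := p.2

theorem P.ext_val {n : ℕ} {p q : P n} (h₁ : p.1.1.1 = q.1.1.1) (h₂ : p.1.2.1 = q.1.2.1) :
    p = q :=
  Subtype.ext (Prod.ext (Fin.ext h₁) (Fin.ext h₂))

theorem key_lt_key_iff {n : ℕ} (p q : P n) :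
    key p < key q ↔ p.1.1.1 < q.1.1.1 ∨ (p.1.1.1 = q.1.1.1 ∧ p.1.2.1 < q.1.2.1) := by
  have hp := p.1.2.2
  have hq := q.1.2.2
  unfold key
  rcases lt_trichotomy p.1.1.1 q.1.1.1 with h | h | h
  · have : (p.1.1.1 + 1) * n ≤ q.1.1.1 * n := Nat.mul_le_mul_right n h
    constructor
    · intro; exact Or.inl h
    · intro; linarith
  · rw [h]; omega
  · have : (q.1.1.1 + 1) * n ≤ p.1.1.1 * n := Nat.mul_le_mul_right n h
    constructor
    · intro; linarith
    · intro; omega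

/-- The bijection on basis wedges underlying the cyclic shift: apply `shiftPair`, and replace the
image of the first row by its complement in the last column. -/
def shiftSet {n : ℕ} : Finset (P n) ≃ Finset (P n) where
  toFun M := Finset.univ.filter fun q => shiftPair.symm q ∈ M ↔ (shiftPair.symm q).1.1.1 ≠ 0
  invFun N := Finset.univ.filter fun p => shiftPair p ∈ N ↔ p.1.1.1 ≠ 0
  left_inv M := by
    ext p
    simp only [Finset.mem_filter, Finset.mem_univ, true_and, Equiv.symm_apply_apply]
    tauto
  right_inv N := by
    ext p
    simp only [Finset.mem_filter, Finset.mem_univ, true_and, Equiv.apply_symm_apply]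
    tauto

theorem shiftPair_mem_shiftSet {n : ℕ} (M : Finset (P n)) (p : P n) :
    shiftPair p ∈ shiftSet M ↔ (p ∈ M ↔ p.1.1.1 ≠ 0) := by
  simp [shiftSet]

/-- Composable pairs `((x, y), (y, z))` of index pairs. -/
abbrev Chain (n : ℕ) : Type := {t : P n × P n // t.1.1.2 = t.2.1.1}

/-- The composite `(x, z)` of a composable pair `((x, y), (y, z))`. -/
def Chain.comp {n : ℕ} (t : Chain n) : P n :=
  ⟨(t.1.1.1.1, t.1.2.1.2), lt_trans t.1.1.2 (by rw [t.2]; exact t.1.2.2)⟩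

theorem Chain.comp_fst {n : ℕ} (t : Chain n) : t.comp.1.1 = t.1.1.1.1 := rfl

theorem Chain.comp_snd {n : ℕ} (t : Chain n) : t.comp.1.2 = t.1.2.1.2 := rfl

theorem Chain.mid {n : ℕ} (t : Chain n) : t.1.1.1.2.1 = t.1.2.1.1.1 := by rw [t.2]

/-- The action of the cyclic shift on composable pairs. -/
def shiftChain {n : ℕ} (t : Chain n) : Chain n :=
  if h : t.1.1.1.1.1 = 0 then
    ⟨(shiftPair t.1.2, shiftPair t.comp), by
      have h1 := t.mid
      have h2 := t.1.1.lt
      have h3 := t.comp_fst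
      have h4 := t.comp_snd
      apply Fin.ext
      rw [shiftPair_fst, shiftPair_snd, if_neg (by omega), if_pos (by rw [h3]; exact h), h4]⟩
  else
    ⟨(shiftPair t.1.1, shiftPair t.1.2), by
      have h1 := t.mid
      have h2 := t.1.1.lt
      apply Fin.ext
      rw [shiftPair_fst, shiftPair_snd, if_neg h, if_neg (by omega), h1]⟩

theorem shiftChain_of_eq {n : ℕ} (t : Chain n) (h : t.1.1.1.1.1 = 0) :
    (shiftChain t).1.1 = shiftPair t.1.2 ∧ (shiftChain t).1.2 = shiftPair t.comp ∧
      (shiftChain t).comp = shiftPair t.1.1 := by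
  have h1 : (shiftChain t).1.1 = shiftPair t.1.2 := by simp only [shiftChain, dif_pos h]
  have h2 : (shiftChain t).1.2 = shiftPair t.comp := by simp only [shiftChain, dif_pos h]
  refine ⟨h1, h2, ?_⟩
  have h3 := t.mid
  have h4 := t.1.1.lt
  apply P.ext_val
  · rw [Chain.comp_fst, h1, shiftPair_fst, shiftPair_fst, if_neg (by omega), if_pos h, h3]
  · rw [Chain.comp_snd, h2, shiftPair_snd, shiftPair_snd, if_pos h, if_pos (by
      rw [Chain.comp_fst]; exact h)]

theorem shiftChain_of_ne {n : ℕ} (t : Chain n) (h : t.1.1.1.1.1 ≠ 0) :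
    (shiftChain t).1.1 = shiftPair t.1.1 ∧ (shiftChain t).1.2 = shiftPair t.1.2 ∧
      (shiftChain t).comp = shiftPair t.comp := by
  have h1 : (shiftChain t).1.1 = shiftPair t.1.1 := by simp only [shiftChain, dif_neg h]
  have h2 : (shiftChain t).1.2 = shiftPair t.1.2 := by simp only [shiftChain, dif_neg h]
  refine ⟨h1, h2, ?_⟩
  have h3 := t.mid
  have h4 := t.1.1.lt
  apply P.ext_val
  · rw [Chain.comp_fst, h1, shiftPair_fst, shiftPair_fst, if_neg h, if_neg (by
      rw [Chain.comp_fst]; exact h), Chain.comp_fst]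
  · rw [Chain.comp_snd, h2, shiftPair_snd, shiftPair_snd, if_neg (by omega), if_neg (by
      rw [Chain.comp_fst]; exact h), Chain.comp_snd]

theorem shiftChain_bijective (n : ℕ) : Function.Bijective (shiftChain (n := n)) := by
  rw [← Finite.injective_iff_bijective]
  intro s t hst
  have hs := s.mid
  have hs' := s.1.1.lt
  have ht := t.mid
  have ht' := t.1.1.lt
  have e1 : (shiftChain s).1.1 = (shiftChain t).1.1 := by rw [hst]
  have e2 : (shiftChain s).1.2 = (shiftChain t).1.2 := by rw [hst]
  have e3 : (shiftChain s).comp = (shiftChain t).comp := by rw [hst]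
  by_cases h : s.1.1.1.1.1 = 0 <;> by_cases h' : t.1.1.1.1.1 = 0
  · rw [(shiftChain_of_eq s h).1, (shiftChain_of_eq t h').1] at e1
    rw [(shiftChain_of_eq s h).2.2, (shiftChain_of_eq t h').2.2] at e3
    exact Subtype.ext (Prod.ext (shiftPair.injective e3) (shiftPair.injective e1))
  · rw [(shiftChain_of_eq s h).2.2, (shiftChain_of_ne t h').2.2] at e3
    have := congrArg (fun p : P n => p.1.1.1) (shiftPair.injective e3)
    simp only [Chain.comp_fst] at this
    omega
  · rw [(shiftChain_of_ne s h).2.2, (shiftChain_of_eq t h').2.2] at e3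
    have := congrArg (fun p : P n => p.1.1.1) (shiftPair.injective e3)
    simp only [Chain.comp_fst] at this
    omega
  · rw [(shiftChain_of_ne s h).1, (shiftChain_of_ne t h').1] at e1
    rw [(shiftChain_of_ne s h).2.1, (shiftChain_of_ne t h').2.1] at e2
    exact Subtype.ext (Prod.ext (shiftPair.injective e1) (shiftPair.injective e2))

/-- The composable pairs contributing a nonzero term to the boundary of `e_M`. -/
def Contributes {n : ℕ} (M : Finset (P n)) (t : Chain n) : Prop :=
  t.1.1 ∈ M ∧ t.1.2 ∈ M ∧ t.comp ∉ M

instance {n : ℕ} (M : Finset (P n)) (t : Chain n) : Decidable (Contributes M t) :=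
  inferInstanceAs (Decidable (_ ∧ _ ∧ _))

/-- Replace the two members of a composable pair by their composite. -/
def contract {n : ℕ} (M : Finset (P n)) (t : Chain n) : Finset (P n) :=
  insert t.comp ((M.erase t.1.1).erase t.1.2)

theorem Chain.fst_ne_snd {n : ℕ} (t : Chain n) : t.1.1 ≠ t.1.2 := by
  intro h
  have h1 := t.mid
  have h2 := t.1.1.lt
  rw [← h] at h1
  omega

theorem Chain.fst_ne_comp {n : ℕ} (t : Chain n) : t.1.1 ≠ t.comp := by
  intro h
  have h1 := t.mid
  have h2 := t.1.2.lt
  have h3 := congrArg (fun p : P n => p.1.2.1) h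
  simp only [Chain.comp_snd] at h3
  omega

theorem Chain.snd_ne_comp {n : ℕ} (t : Chain n) : t.1.2 ≠ t.comp := by
  intro h
  have h1 := t.mid
  have h2 := t.1.1.lt
  have h3 := congrArg (fun p : P n => p.1.1.1) h
  simp only [Chain.comp_fst] at h3
  omega

theorem contributes_shift {n : ℕ} (M : Finset (P n)) (t : Chain n) :
    Contributes (shiftSet M) (shiftChain t) ↔ Contributes M t := by
  have h1 := t.mid
  have h2 := t.1.1.lt
  unfold Contributes
  by_cases h : t.1.1.1.1.1 = 0
  · obtain ⟨e1, e2, e3⟩ := shiftChain_of_eq t h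
    rw [e1, e2, e3]
    simp only [shiftPair_mem_shiftSet, Chain.comp_fst]
    have : t.1.2.1.1.1 ≠ 0 := by omega
    tauto
  · obtain ⟨e1, e2, e3⟩ := shiftChain_of_ne t h
    rw [e1, e2, e3]
    simp only [shiftPair_mem_shiftSet, Chain.comp_fst]
    have : t.1.2.1.1.1 ≠ 0 := by omega
    tauto

theorem sum_contract {n : ℕ} {A : Type*} [AddCommGroup A] {M : Finset (P n)} {t : Chain n}
    (h : Contributes M t) (f : P n → A) :
    ∑ p ∈ contract M t, f p = ∑ p ∈ M, f p - f t.1.1 - f t.1.2 + f t.comp := by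
  unfold contract
  rw [Finset.sum_insert, Finset.sum_erase_eq_sub, Finset.sum_erase_eq_sub h.1]
  · abel
  · exact Finset.mem_erase.2 ⟨t.fst_ne_snd.symm, h.2.1⟩
  · simp [h.2.2]

theorem card_contract {n : ℕ} {M : Finset (P n)} {t : Chain n} (h : Contributes M t) :
    ((contract M t).card : ℤ) = M.card - 1 := by
  have := sum_contract h (fun _ => (1 : ℤ))
  simp only [Finset.sum_const, nsmul_eq_mul, mul_one] at this
  linarith

theorem card_contract_ne {n : ℕ} {M : Finset (P n)} {t : Chain n} (h₁ : t.1.1 ∈ M)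
    (h₂ : t.1.2 ∈ M) (h : t.comp ∈ M) : ((contract M t).card : ℤ) ≠ M.card - 1 := by
  unfold contract
  rw [Finset.insert_eq_of_mem, Finset.card_erase_of_mem, Finset.card_erase_of_mem h₁]
  · have : 1 < M.card := Finset.one_lt_card.2 ⟨_, h₁, _, h₂, t.fst_ne_snd⟩
    omega
  · exact Finset.mem_erase.2 ⟨t.fst_ne_snd.symm, h₂⟩
  · exact Finset.mem_erase.2 ⟨t.snd_ne_comp.symm, Finset.mem_erase.2 ⟨t.fst_ne_comp.symm, h⟩⟩

theorem wt_eq_sum {n : ℕ} (M : Finset (P n)) (i : Fin n) :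
    wt M i = (i.1 : ℤ) + 1 +
      ∑ p ∈ M, ((if p.1.1 = i then 1 else 0) - (if p.1.2 = i then 1 else 0)) := by
  simp only [wt, Finset.sum_sub_distrib, Finset.sum_boole]
  ring

theorem wt_contract {n : ℕ} {M : Finset (P n)} {t : Chain n} (h : Contributes M t) :
    wt (contract M t) = wt M := by
  funext i
  rw [wt_eq_sum, wt_eq_sum, sum_contract h, Chain.comp_fst, Chain.comp_snd, t.2]
  ring

theorem sum_shiftSet {n : ℕ} {A : Type*} [AddCommGroup A] (M : Finset (P n)) (f : P n → A) :
    ∑ q ∈ shiftSet M, f q =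
      ∑ p ∈ M, (if p.1.1.1 = 0 then -f (shiftPair p) else f (shiftPair p)) +
        ∑ p : P n with p.1.1.1 = 0, f (shiftPair p) := by
  rw [← Finset.univ_inter (shiftSet M), ← Finset.sum_ite_mem, ← Equiv.sum_comp shiftPair,
    ← Finset.univ_inter M, ← Finset.sum_ite_mem, Finset.sum_filter, ← Finset.sum_add_distrib]
  refine Finset.sum_congr rfl fun p _ => ?_
  simp only [shiftPair_mem_shiftSet]
  by_cases h : p ∈ M <;> by_cases h0 : p.1.1.1 = 0 <;> simp [h, h0]

theorem sum_first_row {n : ℕ} (hn : 0 < n) (g : Fin n → ℤ) :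
    ∑ p : P n with p.1.1.1 = 0, g p.1.2 = ∑ y, g y - g ⟨0, hn⟩ := by
  rw [← Finset.sum_erase_eq_sub (Finset.mem_univ _)]
  refine Finset.sum_bij (fun p _ => p.1.2) ?_ ?_ ?_ ?_
  · intro p hp
    refine Finset.mem_erase.2 ⟨fun h => ?_, Finset.mem_univ _⟩
    have := p.lt
    rw [h] at this
    exact absurd this (Nat.not_lt_zero _)
  · intro p hp q hq h
    simp only [Finset.mem_filter, Finset.mem_univ, true_and] at hp hq
    exact P.ext_val (hp.trans hq.symm) (congrArg Fin.val h)
  · intro y hy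
    have h0 : y.1 ≠ 0 := fun h => (Finset.mem_erase.1 hy).1 (Fin.ext h)
    exact ⟨⟨(⟨0, hn⟩, y), Nat.pos_of_ne_zero h0⟩, by simp, rfl⟩
  · intros; rfl

theorem card_shiftSet {n : ℕ} (hn : 0 < n) (M : Finset (P n)) :
    ((shiftSet M).card : ℤ) = M.card - (2 * wt M ⟨0, hn⟩ - n - 1) := by
  have h1 := sum_shiftSet M (fun _ => (1 : ℤ))
  have h2 := sum_first_row hn (fun _ => 1)
  have h3 : ∑ p ∈ M, (if p.1.1.1 = 0 then -1 else (1 : ℤ)) =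
      ∑ p ∈ M, (1 - 2 * ((if p.1.1 = ⟨0, hn⟩ then 1 else 0) -
        (if p.1.2 = ⟨0, hn⟩ then 1 else 0))) := by
    refine Finset.sum_congr rfl fun p _ => ?_
    have := p.lt
    have h : p.1.2.1 ≠ 0 := by omega
    simp only [Fin.ext_iff, h, if_false]
    split_ifs <;> rfl
  rw [h2, h3, Finset.sum_sub_distrib, ← Finset.mul_sum] at h1
  rw [wt_eq_sum]
  simp only [Finset.sum_const, nsmul_eq_mul, mul_one, Finset.card_univ, Fintype.card_fin] at h1
  rw [h1]
  push_cast
  ring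

theorem wt_shiftSet {n : ℕ} (M : Finset (P n)) : wt (shiftSet M) = cyc (wt M) := by
  funext j
  have hn : 0 < n := j.pos
  have hj := j.2
  simp only [cyc]
  rw [wt_eq_sum, wt_eq_sum, sum_shiftSet]
  by_cases hlast : j.1 + 1 = n
  · have h0 : (⟨(j.1 + 1) % n, Nat.mod_lt _ hn⟩ : Fin n) = ⟨0, hn⟩ := by
      simp [hlast]
    rw [h0]
    have h1 : ∀ p : P n, p.1.1.1 = 0 → (if (shiftPair p).1.1 = j then (1 : ℤ) else 0) -
        (if (shiftPair p).1.2 = j then 1 else 0) = -1 := by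
      intro p hp
      have h2 := p.lt
      have h3 := p.1.2.2
      simp only [Fin.ext_iff, shiftPair_fst, shiftPair_snd, hp, if_true]
      rw [if_neg (by omega), if_pos (by omega)]
      rfl
    have h2 := sum_first_row hn (fun _ => -1)
    rw [Finset.sum_congr rfl (fun p hp => h1 p (Finset.mem_filter.1 hp).2), h2,
      Finset.sum_congr rfl (g := fun p : P n => (if p.1.1 = ⟨0, hn⟩ then (1 : ℤ) else 0) -
        (if p.1.2 = ⟨0, hn⟩ then 1 else 0))]
    · simp only [Finset.sum_const, Finset.card_univ, Fintype.card_fin, nsmul_eq_mul]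
      have : (j.1 : ℤ) + 1 = n := by exact_mod_cast hlast
      push_cast
      linarith
    · intro p _
      have h2 := p.lt
      have h3 := p.1.2.2
      by_cases hp : p.1.1.1 = 0
      · rw [if_pos hp, h1 p hp]
        simp only [Fin.ext_iff]
        rw [if_pos hp, if_neg (by omega)]
        rfl
      · simp only [Fin.ext_iff, shiftPair_fst, shiftPair_snd, hp, if_false]
        rw [if_neg (by omega), if_neg (by omega), if_neg (by omega)]
  · have h0 : (⟨(j.1 + 1) % n, Nat.mod_lt _ hn⟩ : Fin n) = ⟨j.1 + 1, by omega⟩ := by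
      simp only [Fin.mk.injEq]
      exact Nat.mod_eq_of_lt (by omega)
    rw [h0]
    have h1 : ∀ p : P n, p.1.1.1 = 0 → (if (shiftPair p).1.1 = j then (1 : ℤ) else 0) -
        (if (shiftPair p).1.2 = j then 1 else 0) = if p.1.2.1 = j.1 + 1 then 1 else 0 := by
      intro p hp
      have h2 := p.lt
      simp only [Fin.ext_iff, shiftPair_fst, shiftPair_snd, hp, if_true]
      rw [if_neg (show ¬ n - 1 = j.1 by omega), sub_zero]
      exact if_congr (by omega) rfl rfl
    have h2 := sum_first_row hn (fun y => if y.1 = j.1 + 1 then 1 else 0)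
    have h3 : ∑ y : Fin n, (if y.1 = j.1 + 1 then (1 : ℤ) else 0) = 1 := by
      rw [Finset.sum_eq_single (⟨j.1 + 1, by omega⟩ : Fin n)]
      · simp
      · intro b _ hb
        rw [if_neg fun h => hb (Fin.ext h)]
      · simp
    rw [Finset.sum_congr rfl (fun p hp => h1 p (Finset.mem_filter.1 hp).2), h2, h3,
      Finset.sum_congr rfl (g := fun p : P n =>
        (if p.1.1 = ⟨j.1 + 1, by omega⟩ then (1 : ℤ) else 0) -
        (if p.1.2 = ⟨j.1 + 1, by omega⟩ then 1 else 0))]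
    · simp only [Nat.cast_add, Nat.cast_one]
      rw [if_neg (by omega)]
      ring
    · intro p _
      have h2 := p.lt
      by_cases hp : p.1.1.1 = 0
      · rw [if_pos hp, h1 p hp]
        simp only [Fin.ext_iff]
        rw [if_neg (show ¬ p.1.1.1 = j.1 + 1 by omega), zero_sub]
      · simp only [Fin.ext_iff, shiftPair_fst, shiftPair_snd, hp, if_false]
        congr 1 <;> exact if_congr (by omega) rfl rfl

theorem shiftSet_contract {n : ℕ} {M : Finset (P n)} {t : Chain n} (h : Contributes M t) :
    shiftSet (contract M t) = contract (shiftSet M) (shiftChain t) := by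
  have h1 := t.mid
  have h2 := t.1.1.lt
  have h3 : t.1.2.1.1.1 ≠ 0 := by omega
  have h4 := t.fst_ne_snd
  have h5 := t.fst_ne_comp
  have h6 := t.snd_ne_comp
  have h7 : t.comp.1.1.1 = t.1.1.1.1.1 := rfl
  obtain ⟨ha, hb, hc⟩ := h
  ext q
  obtain ⟨p, rfl⟩ := shiftPair.surjective q
  rw [shiftPair_mem_shiftSet]
  unfold contract
  by_cases h : t.1.1.1.1.1 = 0
  · obtain ⟨e1, e2, e3⟩ := shiftChain_of_eq t h
    rw [e1, e2, e3]
    simp only [Finset.mem_insert, Finset.mem_erase, shiftPair_mem_shiftSet, ne_eq,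
      EmbeddingLike.apply_eq_iff_eq]
    by_cases pa : p = t.1.1
    · subst pa; simp [h4, h5, h]
    by_cases pb : p = t.1.2
    · subst pb; simp [h4.symm, h6, h3]
    by_cases pc : p = t.comp
    · subst pc; simp [h5.symm, h6.symm, h7, h]
    simp [pa, pb, pc]
  · obtain ⟨e1, e2, e3⟩ := shiftChain_of_ne t h
    rw [e1, e2, e3]
    simp only [Finset.mem_insert, Finset.mem_erase, shiftPair_mem_shiftSet, ne_eq,
      EmbeddingLike.apply_eq_iff_eq]
    by_cases pa : p = t.1.1
    · subst pa; simp [h4, h5, h]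
    by_cases pb : p = t.1.2
    · subst pb; simp [h4.symm, h6, h3]
    by_cases pc : p = t.comp
    · subst pc; simp [h5.symm, h6.symm, h7, h]
    simp [pa, pb, pc]

/-- The indicator, modulo two, of `p` preceding `q` lexicographically. -/
def precedes {n : ℕ} (p q : P n) : ZMod 2 := if key p < key q then 1 else 0

theorem pos_eq_sum {n : ℕ} (M : Finset (P n)) (q : P n) :
    (pos M q : ZMod 2) = ∑ p ∈ M, precedes p q := by
  simp [pos, precedes, Finset.sum_boole]

theorem pos_contract {n : ℕ} {M : Finset (P n)} {t : Chain n} (h : Contributes M t) :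
    (pos (contract M t) t.comp : ZMod 2) = pos M t.comp + 1 := by
  have h1 := t.mid
  have h2 := t.1.1.lt
  have h3 := t.1.2.lt
  have k1 : precedes t.1.1 t.comp = 1 := by
    rw [precedes, if_pos]
    rw [key_lt_key_iff, Chain.comp_fst, Chain.comp_snd]
    omega
  have k2 : precedes t.1.2 t.comp = 0 := by
    rw [precedes, if_neg]
    rw [key_lt_key_iff, Chain.comp_fst, Chain.comp_snd]
    omega
  have k3 : precedes t.comp t.comp = 0 := by simp [precedes]
  rw [pos_eq_sum, pos_eq_sum, sum_contract h, k1, k2, k3]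
  simp only [CharTwo.sub_eq_add]
  ring

/-- The indicator, modulo two, of `p` outside the first row changing its order relative to `q` in
the first row under `shiftPair`. -/
def crossing {n : ℕ} (p q : P n) : ZMod 2 :=
  if p.1.1.1 ≠ 0 ∧ q.1.1.1 = 0 ∧ p.1.1.1 ≤ q.1.2.1 then 1 else 0

theorem crossing_add_crossing {n : ℕ} (p q : P n) :
    crossing p q + crossing q p = precedes p q + precedes (shiftPair p) (shiftPair q) := by
  have hp := p.lt
  have hq := q.lt
  have hp' := p.1.2.2
  have hq' := q.1.2.2
  simp only [crossing, precedes, key_lt_key_iff, shiftPair_fst, shiftPair_snd]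
  by_cases h : p.1.1.1 = 0 <;> by_cases h' : q.1.1.1 = 0 <;>
    simp only [h, h', if_true, if_false, true_and, false_and, not_true_eq_false, not_false_eq_true,
      or_false, ne_eq] <;>
    split_ifs <;> first | rfl | omega

/-- The linear part of the sign exponent of the cyclic shift. -/
def shiftLinear {n : ℕ} (p : P n) : ZMod 2 :=
  ∑ q : P n with q.1.1.1 = 0, precedes (shiftPair q) (shiftPair p) +
    if p.1.1.1 = 0 then 1 else 0

/-- The exponent, modulo two, of the sign of the cyclic shift on a basis wedge. -/
def shiftSign {n : ℕ} (M : Finset (P n)) : ZMod 2 :=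
  ∑ p ∈ M, ∑ q ∈ M, crossing p q + ∑ p ∈ M, shiftLinear p

theorem pos_shiftSet {n : ℕ} (M : Finset (P n)) (q : P n) :
    (pos (shiftSet M) (shiftPair q) : ZMod 2) = pos M q +
      (∑ p ∈ M, crossing p q + ∑ p ∈ M, crossing q p) + shiftLinear q +
        if q.1.1.1 = 0 then 1 else 0 := by
  rw [pos_eq_sum, pos_eq_sum, sum_shiftSet, ← Finset.sum_add_distrib,
    ← Finset.sum_add_distrib, shiftLinear]
  have h : ∀ p : P n, (if p.1.1.1 = 0 then -precedes (shiftPair p) (shiftPair q) else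
      precedes (shiftPair p) (shiftPair q)) =
      precedes p q + (crossing p q + crossing q p) := by
    intro p
    rw [crossing_add_crossing, ← add_assoc, CharTwo.add_self_eq_zero, zero_add,
      CharTwo.neg_eq, ite_self]
  simp only [h]
  rw [add_assoc _ (_ + _), add_assoc (∑ p : P n with p.1.1.1 = 0, _),
    CharTwo.add_self_eq_zero, add_zero]

theorem crossing_chain {n : ℕ} (t : Chain n) :
    (crossing t.1.1 t.1.1 + crossing t.1.1 t.1.2 + crossing t.1.1 t.comp) +
    (crossing t.1.2 t.1.1 + crossing t.1.2 t.1.2 + crossing t.1.2 t.comp) +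
    (crossing t.comp t.1.1 + crossing t.comp t.1.2 + crossing t.comp t.comp) = 0 := by
  have h1 := t.mid
  have h2 := t.1.1.lt
  have h3 := t.1.2.lt
  simp only [crossing, Chain.comp_fst, Chain.comp_snd]
  have h5 : t.1.2.1.1.1 ≠ 0 := by omega
  by_cases h : t.1.1.1.1.1 = 0
  · have h6 : t.1.2.1.1.1 ≤ t.1.1.1.2.1 := by omega
    simp only [h, h5, h6, h3.le]
    simp [h5, CharTwo.add_self_eq_zero]
  · simp [h, h5]

theorem shiftSign_contract {n : ℕ} {M : Finset (P n)} {t : Chain n} (h : Contributes M t) :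
    shiftSign (contract M t) = shiftSign M +
      (∑ p ∈ M, crossing p t.1.1 + ∑ p ∈ M, crossing t.1.1 p + shiftLinear t.1.1) +
      (∑ p ∈ M, crossing p t.1.2 + ∑ p ∈ M, crossing t.1.2 p + shiftLinear t.1.2) +
      (∑ p ∈ M, crossing p t.comp + ∑ p ∈ M, crossing t.comp p + shiftLinear t.comp) := by
  have hc := crossing_chain t
  unfold shiftSign
  simp only [sum_contract h, CharTwo.sub_eq_add, Finset.sum_add_distrib]
  linear_combination hc

/-- The exponent of the sign of the term of the boundary of `e_M` coming from `t`. -/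
def chainSign {n : ℕ} (M : Finset (P n)) (t : Chain n) : ℕ :=
  pos M t.1.1 + pos M t.1.2 + pos (contract M t) t.comp

theorem chainSign_shift {n : ℕ} {M : Finset (P n)} {t : Chain n} (h : Contributes M t) :
    (chainSign (shiftSet M) (shiftChain t) : ZMod 2) + shiftSign M =
      chainSign M t + shiftSign (contract M t) := by
  have hs : (chainSign (shiftSet M) (shiftChain t) : ZMod 2) =
      pos (shiftSet M) (shiftPair t.1.1) + pos (shiftSet M) (shiftPair t.1.2) +
        pos (shiftSet M) (shiftPair t.comp) + 1 := by
    rw [chainSign]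
    push_cast
    rw [pos_contract ((contributes_shift M t).2 h)]
    by_cases h0 : t.1.1.1.1.1 = 0
    · obtain ⟨e1, e2, e3⟩ := shiftChain_of_eq t h0
      rw [e1, e2, e3]
      ring
    · obtain ⟨e1, e2, e3⟩ := shiftChain_of_ne t h0
      rw [e1, e2, e3]
      ring
  have h1 := t.mid
  have h2 := t.1.1.lt
  have h3 : t.1.2.1.1.1 ≠ 0 := by omega
  rw [hs, chainSign]
  push_cast
  rw [pos_contract h, shiftSign_contract h, pos_shiftSet, pos_shiftSet, pos_shiftSet, if_neg h3,
    Chain.comp_fst]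
  have h4 : (if t.1.1.1.1.1 = 0 then (1 : ZMod 2) else 0) +
    (if t.1.1.1.1.1 = 0 then 1 else 0) = 0 := CharTwo.add_self_eq_zero _
  linear_combination h4

/-- The linear extension of the boundary of `e_M` to formal combinations of all basis wedges. -/
noncomputable def bdry (n : ℕ) : (Finset (P n) →₀ ℤ) →ₗ[ℤ] (Finset (P n) →₀ ℤ) :=
  Finsupp.lsum ℤ fun M => LinearMap.toSpanSingleton ℤ _
    (∑ t : Chain n, if Contributes M t then
      (-1 : ℤ) ^ chainSign M t • Finsupp.single (contract M t) 1 else 0)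

/-- The inclusion of a graded piece of a weight summand into formal combinations of all basis
wedges. -/
noncomputable def inclAll (n : ℕ) (k : ℤ) (w : Fin n → ℤ) : Cw n k w →ₗ[ℤ] (Finset (P n) →₀ ℤ) :=
  Finsupp.lmapDomain ℤ ℤ Subtype.val

theorem inclAll_injective (n : ℕ) (k : ℤ) (w : Fin n → ℤ) :
    Function.Injective (inclAll n k w) :=
  Finsupp.mapDomain_injective Subtype.val_injective

theorem inclAll_single {n : ℕ} {k : ℤ} {w : Fin n → ℤ} (M : Bw n k w) (c : ℤ) :
    inclAll n k w (Finsupp.single M c) = Finsupp.single M.1 c := by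
  simp [inclAll, Finsupp.mapDomain_single]

theorem dAux_eq_sum {n : ℕ} (k : ℤ) (M : Finset (P n)) :
    dAux k M = ∑ t : Chain n, if t.1.1 ∈ M ∧ t.1.2 ∈ M then
      (if h : ((contract M t).card : ℤ) = k then
        (-1 : ℤ) ^ chainSign M t • Finsupp.single (⟨contract M t, h⟩ : B n k) 1 else 0)
      else 0 := by
  unfold dAux
  rw [← Finset.sum_product', ← Finset.univ_inter (M ×ˢ M), ← Finset.sum_ite_mem]
  symm
  refine Fintype.sum_of_injective (Subtype.val : Chain n → P n × P n) Subtype.val_injective _ _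
    ?_ ?_
  · intro x hx
    rw [dif_neg, ite_self]
    exact fun h => hx ⟨⟨x, h⟩, rfl⟩
  · intro t
    rw [dif_pos t.2]
    simp only [Finset.mem_product]
    rfl

theorem inclAll_dW {n : ℕ} {k : ℤ} {w : Fin n → ℤ} (x : Cw n (k + 1) w) :
    inclAll n k w (dW n k w x) = bdry n (inclAll n (k + 1) w x) := by
  suffices h : inclAll n k w ∘ₗ dW n k w = bdry n ∘ₗ inclAll n (k + 1) w from
    LinearMap.congr_fun h x
  ext M : 2
  obtain ⟨M, hM, hw⟩ := M
  simp only [LinearMap.comp_apply, Finsupp.lsingle_apply, dW, inclAll_single, inclW, d, bdry,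
    Finsupp.lmapDomain_apply, Finsupp.mapDomain_single, Finsupp.lsum_single,
    LinearMap.toSpanSingleton_apply, one_smul]
  rw [dAux_eq_sum, map_sum, map_sum]
  refine Finset.sum_congr rfl fun t _ => ?_
  by_cases hab : t.1.1 ∈ M ∧ t.1.2 ∈ M
  · rw [if_pos hab]
    by_cases hc : t.comp ∈ M
    · have := card_contract_ne hab.1 hab.2 hc
      rw [dif_neg (by omega), if_neg fun h => h.2.2 hc, map_zero, map_zero]
    · have hC : Contributes M t := ⟨hab.1, hab.2, hc⟩
      have h1 := card_contract hC
      have h2 := (wt_contract hC).trans hw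
      rw [dif_pos (by omega), if_pos hC]
      simp only [map_smul, projW, Finsupp.lsum_single, dif_pos h2,
        LinearMap.toSpanSingleton_apply, one_smul, inclAll_single]
  · rw [if_neg hab, if_neg fun h => hab ⟨h.1, h.2.1⟩, map_zero, map_zero]

/-- The signed cyclic shift on formal combinations of all basis wedges. -/
noncomputable def shiftAll (n : ℕ) : (Finset (P n) →₀ ℤ) →ₗ[ℤ] (Finset (P n) →₀ ℤ) :=
  Finsupp.lsum ℤ fun M => LinearMap.toSpanSingleton ℤ _
    ((((-1 : ℤˣ) ^ shiftSign M : ℤˣ) : ℤ) • Finsupp.single (shiftSet M) 1)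

theorem shiftAll_single {n : ℕ} (M : Finset (P n)) :
    shiftAll n (Finsupp.single M 1) =
      (((-1 : ℤˣ) ^ shiftSign M : ℤˣ) : ℤ) • Finsupp.single (shiftSet M) 1 := by
  simp [shiftAll]

theorem bdry_single {n : ℕ} (M : Finset (P n)) :
    bdry n (Finsupp.single M 1) = ∑ t : Chain n, if Contributes M t then
      (-1 : ℤ) ^ chainSign M t • Finsupp.single (contract M t) 1 else 0 := by
  simp only [bdry, Finsupp.lsum_single, LinearMap.toSpanSingleton_apply, one_smul]

theorem neg_one_pow_eq_units (a : ℕ) :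
    (-1 : ℤ) ^ a = (((-1 : ℤˣ) ^ (a : ZMod 2) : ℤˣ) : ℤ) := by
  rw [uzpow_natCast]
  push_cast
  rfl

theorem bdry_shiftAll {n : ℕ} (x : Finset (P n) →₀ ℤ) :
    bdry n (shiftAll n x) = shiftAll n (bdry n x) := by
  suffices h : bdry n ∘ₗ shiftAll n = shiftAll n ∘ₗ bdry n from LinearMap.congr_fun h x
  ext M : 2
  simp only [LinearMap.comp_apply, Finsupp.lsingle_apply]
  rw [shiftAll_single, map_smul, bdry_single, bdry_single, map_sum, Finset.smul_sum,
    ← (shiftChain_bijective n).sum_comp]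
  refine Finset.sum_congr rfl fun t _ => ?_
  by_cases h : Contributes M t
  · rw [if_pos h, if_pos ((contributes_shift M t).2 h), map_smul, shiftAll_single,
      shiftSet_contract h, smul_smul, smul_smul, neg_one_pow_eq_units, neg_one_pow_eq_units,
      ← Units.val_mul, ← Units.val_mul, ← uzpow_add, ← uzpow_add, add_comm (shiftSign M),
      chainSign_shift h]
  · rw [if_neg h, if_neg (mt (contributes_shift M t).1 h), map_zero, smul_zero]

theorem cyc_injective {n : ℕ} : Function.Injective (cyc (n := n)) := by
  intro v w h
  funext i
  have hi := i.2
  by_cases h0 : i.1 = 0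
  · have := congrFun h ⟨n - 1, by omega⟩
    have e : (⟨(n - 1 + 1) % n, Nat.mod_lt _ i.pos⟩ : Fin n) = i := by
      apply Fin.ext
      simp only [h0]
      rw [Nat.sub_add_cancel i.pos, Nat.mod_self]
    simpa only [cyc, e] using this
  · have := congrFun h ⟨i.1 - 1, by omega⟩
    have e : (⟨(i.1 - 1 + 1) % n, Nat.mod_lt _ i.pos⟩ : Fin n) = i := by
      apply Fin.ext
      simp only
      rw [Nat.sub_add_cancel (by omega), Nat.mod_eq_of_lt hi]
    simpa only [cyc, e] using this

/-- The bijection between the basis wedges of weight `w` and those of weight `cyc w`. -/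
def shiftBw {n : ℕ} (hn : 0 < n) (w : Fin n → ℤ) (k : ℤ) :
    Bw n k w ≃ Bw n (k - (2 * w ⟨0, hn⟩ - n - 1)) (cyc w) :=
  shiftSet.subtypeEquiv fun M => by
    rw [card_shiftSet hn, wt_shiftSet, cyc_injective.eq_iff]
    constructor
    · rintro ⟨rfl, rfl⟩
      exact ⟨rfl, rfl⟩
    · rintro ⟨h, rfl⟩
      exact ⟨by linarith, rfl⟩

/-- The signed cyclic shift in a single degree. -/
noncomputable def shiftEquiv {n : ℕ} (hn : 0 < n) (w : Fin n → ℤ) (k : ℤ) :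
    Cw n k w ≃ₗ[ℤ] Cw n (k - (2 * w ⟨0, hn⟩ - n - 1)) (cyc w) :=
  ((Finsupp.basisSingleOne (R := ℤ)).equiv
    ((Finsupp.basisSingleOne (R := ℤ)).unitsSMul fun M : Bw n k w => (-1 : ℤˣ) ^ shiftSign M.1)
    (Equiv.refl _)).trans (Finsupp.domLCongr (shiftBw hn w k))

theorem shiftEquiv_single {n : ℕ} (hn : 0 < n) (w : Fin n → ℤ) (k : ℤ) (M : Bw n k w) :
    shiftEquiv hn w k (Finsupp.single M 1) =
      (((-1 : ℤˣ) ^ shiftSign M.1 : ℤˣ) : ℤ) • Finsupp.single (shiftBw hn w k M) 1 := by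
  have h := (Finsupp.basisSingleOne (R := ℤ)).equiv_apply M
    ((Finsupp.basisSingleOne (R := ℤ)).unitsSMul fun M : Bw n k w => (-1 : ℤˣ) ^ shiftSign M.1)
    (Equiv.refl _)
  rw [Finsupp.coe_basisSingleOne] at h
  rw [shiftEquiv, LinearEquiv.trans_apply, h, Module.Basis.unitsSMul_apply,
    Finsupp.coe_basisSingleOne, Units.smul_def, map_smul, Finsupp.domLCongr_single]
  rfl

theorem inclAll_shiftEquiv {n : ℕ} (hn : 0 < n) (w : Fin n → ℤ) (k : ℤ) (x : Cw n k w) :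
    inclAll n _ _ (shiftEquiv hn w k x) = shiftAll n (inclAll n k w x) := by
  suffices h : inclAll n _ _ ∘ₗ (shiftEquiv hn w k).toLinearMap = shiftAll n ∘ₗ inclAll n k w from
    LinearMap.congr_fun h x
  ext M : 2
  simp only [LinearMap.comp_apply, Finsupp.lsingle_apply, LinearEquiv.coe_coe]
  rw [shiftEquiv_single, map_smul, inclAll_single, inclAll_single, shiftAll_single]
  rfl

theorem inclAll_castCw {n : ℕ} (w : Fin n → ℤ) {k l : ℤ} (h : k = l) (x : Cw n k w) :
    inclAll n l w (castCw n w h x) = inclAll n k w x := by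
  suffices h : inclAll n l w ∘ₗ (castCw n w h).toLinearMap = inclAll n k w from
    LinearMap.congr_fun h x
  ext M : 2
  simp only [LinearMap.comp_apply, Finsupp.lsingle_apply, LinearEquiv.coe_coe, castCw,
    Finsupp.domLCongr_single, inclAll_single]
  rfl

/-- Lemma 2.3: `⟦w₁, w₂, …, w_n⟧ ≅ ⟦w₂, …, w_n, w₁⟧` with degrees shifted by `2w₁-n-1`:
there is a family of isomorphisms commuting with the boundaries. -/
theorem cyclic_shift_iso (n : ℕ) (hn : 0 < n) (w : Fin n → ℤ) (hw : Sn n w) :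
    ∃ e : (k : ℤ) → Cw n k w ≃ₗ[ℤ] Cw n (k - (2 * w ⟨0, hn⟩ - n - 1)) (cyc w),
      ∀ k : ℤ,
        (dW n (k - (2 * w ⟨0, hn⟩ - n - 1)) (cyc w)) ∘ₗ
          (castCw n (cyc w)
            (by ring : k + 1 - (2 * w ⟨0, hn⟩ - n - 1) = (k - (2 * w ⟨0, hn⟩ - n - 1)) + 1)).toLinearMap ∘ₗ
          (e (k + 1)).toLinearMap =
        (e k).toLinearMap ∘ₗ dW n k w := by
  refine ⟨shiftEquiv hn w, fun k => LinearMap.ext fun x => inclAll_injective _ _ _ ?_⟩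
  simp only [LinearMap.comp_apply, LinearEquiv.coe_coe]
  rw [inclAll_dW, inclAll_castCw, inclAll_shiftEquiv, inclAll_shiftEquiv, inclAll_dW,
    bdry_shiftAll]

end Nil
end

section
/- Let π ∈ S_n be a permutation and w = (π(1), …, π(n)) ∈ 𝒮_n. Then the complex ⟦w⟧ is a free ℤ-module of rank 1, generated by the single basis wedge e_π = ∧_{i<j, π(i)>π(j)} e_{ij} (the wedge over all inversions of π), whose degree is the number of inversions of π. Consequently H_k⟦w⟧ ≅ ℤ if k = inv(π) and H_k⟦w⟧ = 0 otherwise. -/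
namespace Nil

/-- The tournament attached to `M`: for `i < j`, the vertex `i` beats `j` iff `(i,j) ∈ M`. -/
def Beats {n : ℕ} (M : Finset (P n)) (i j : Fin n) : Prop :=
  (∃ h : i < j, (⟨(i, j), h⟩ : P n) ∈ M) ∨ ∃ h : j < i, (⟨(j, i), h⟩ : P n) ∉ M

lemma beats_iff_mem {n : ℕ} {M : Finset (P n)} {i j : Fin n} (h : i < j) :
    Beats M i j ↔ (⟨(i, j), h⟩ : P n) ∈ M := by
  simp [Beats, h, h.not_gt]

lemma not_beats_self {n : ℕ} (M : Finset (P n)) (i : Fin n) : ¬ Beats M i i := by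
  simp [Beats]

lemma beats_comm_iff_not {n : ℕ} {M : Finset (P n)} {i j : Fin n} (h : i ≠ j) :
    Beats M i j ↔ ¬ Beats M j i := by
  rcases h.lt_or_gt with h | h <;> simp [Beats, h, h.not_gt]

lemma card_filter_fst {n : ℕ} (M : Finset (P n)) (i : Fin n) :
    (M.filter fun p => p.1.1 = i).card =
      Nat.card {j : Fin n // ∃ h : i < j, (⟨(i, j), h⟩ : P n) ∈ M} := by
  classical
  rw [Nat.card_eq_fintype_card, Fintype.card_subtype]
  refine Finset.card_bij (fun p _ => p.1.2) ?_ ?_ ?_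
  · rintro ⟨⟨a, b⟩, hab⟩ hp
    obtain ⟨hM, rfl⟩ := Finset.mem_filter.mp hp
    simpa using ⟨hab, hM⟩
  · rintro ⟨⟨a, b⟩, hab⟩ hp ⟨⟨a', b'⟩, hab'⟩ hp' h
    simp_all
  · intro j hj
    obtain ⟨h, hM⟩ := (Finset.mem_filter.mp hj).2
    exact ⟨⟨(i, j), h⟩, by simpa using hM, rfl⟩

lemma card_filter_snd {n : ℕ} (M : Finset (P n)) (i : Fin n) :
    (M.filter fun p => p.1.2 = i).card =
      Nat.card {j : Fin n // ∃ h : j < i, (⟨(j, i), h⟩ : P n) ∈ M} := by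
  classical
  rw [Nat.card_eq_fintype_card, Fintype.card_subtype]
  refine Finset.card_bij (fun p _ => p.1.1) ?_ ?_ ?_
  · rintro ⟨⟨a, b⟩, hab⟩ hp
    obtain ⟨hM, rfl⟩ := Finset.mem_filter.mp hp
    simpa using ⟨hab, hM⟩
  · rintro ⟨⟨a, b⟩, hab⟩ hp ⟨⟨a', b'⟩, hab'⟩ hp' h
    simp_all
  · intro j hj
    obtain ⟨h, hM⟩ := (Finset.mem_filter.mp hj).2
    exact ⟨⟨(j, i), h⟩, by simpa using hM, rfl⟩

/-- The modified weight is, up to the shift by one, the score sequence of the tournament. -/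
lemma wt_eq_score {n : ℕ} (M : Finset (P n)) (i : Fin n) :
    wt M i = (Nat.card {j : Fin n // Beats M i j} : ℤ) + 1 := by
  classical
  have hout : Nat.card {j : Fin n // Beats M i j} =
      Nat.card {j : Fin n // ∃ h : i < j, (⟨(i, j), h⟩ : P n) ∈ M} +
        Nat.card {j : Fin n // ∃ h : j < i, (⟨(j, i), h⟩ : P n) ∉ M} := by
    simp only [Nat.card_eq_fintype_card, Fintype.card_subtype, Beats]
    rw [Finset.filter_or, Finset.card_union_of_disjoint]
    exact Finset.disjoint_filter.mpr fun j _ ⟨h, _⟩ ⟨h', _⟩ => lt_asymm h h'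
  have hin : Nat.card {j : Fin n // ∃ h : j < i, (⟨(j, i), h⟩ : P n) ∈ M} +
      Nat.card {j : Fin n // ∃ h : j < i, (⟨(j, i), h⟩ : P n) ∉ M} = i.1 := by
    simp only [Nat.card_eq_fintype_card, Fintype.card_subtype]
    rw [← Finset.card_union_of_disjoint, ← Finset.filter_or, ← Fin.card_Iio i]
    · congr 1
      ext j
      simp only [Finset.mem_filter, Finset.mem_univ, true_and, Finset.mem_Iio]
      by_cases h : j < i
      · simpa [h] using em _
      · simp [h]
    · exact Finset.disjoint_filter.mpr fun j _ ⟨_, h⟩ ⟨_, h'⟩ => h' h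
  unfold wt
  rw [card_filter_fst, card_filter_snd, hout]
  omega

lemma card_perm_lt {n : ℕ} (π : Equiv.Perm (Fin n)) (v : Fin n) :
    Nat.card {j : Fin n // π j < v} = v.1 := by
  rw [Nat.card_congr (π.subtypeEquiv (q := fun j => j < v) fun _ => Iff.rfl)]
  rw [Nat.card_eq_fintype_card, Fintype.card_subtype, ← Fin.card_Iio v]
  congr 1
  ext j
  simp

lemma beats_invFinset {n : ℕ} (π : Equiv.Perm (Fin n)) (i j : Fin n) :
    Beats (invFinset π) i j ↔ π j < π i := by
  rcases lt_trichotomy i j with h | rfl | h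
  · simp [beats_iff_mem h, invFinset]
  · simp [not_beats_self]
  · rw [beats_comm_iff_not h.ne', beats_iff_mem h]
    have : π i ≠ π j := fun e => h.ne' (π.injective e)
    simp only [invFinset, Finset.mem_filter, Finset.mem_univ, true_and, not_lt]
    exact this.symm.le_iff_lt

/-- A tournament whose scores are the values of a permutation is transitive. -/
lemma beats_iff_of_wt_eq {n : ℕ} {M : Finset (P n)} {π : Equiv.Perm (Fin n)}
    (hM : wt M = permWt n π) (i : Fin n) : ∀ j, Beats M i j ↔ π j < π i := by
  induction hv : π i using WellFoundedLT.induction generalizing i with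
  | ind v ih =>
    subst hv
    classical
    have hsub : (Finset.univ.filter fun j => π j < π i) ⊆
        Finset.univ.filter fun j => Beats M i j := by
      intro j hj
      have hj : π j < π i := (Finset.mem_filter.mp hj).2
      have hne : i ≠ j := by rintro rfl; exact lt_irrefl _ hj
      refine Finset.mem_filter.mpr ⟨Finset.mem_univ _, ?_⟩
      rw [beats_comm_iff_not hne, ih _ hj j rfl i]
      exact hj.not_gt
    have hscore : Nat.card {j // Beats M i j} = Nat.card {j // π j < π i} := by
      have h := congrFun hM i
      rw [wt_eq_score, permWt] at h
      rw [card_perm_lt]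
      omega
    rw [Nat.card_eq_fintype_card, Nat.card_eq_fintype_card, Fintype.card_subtype,
      Fintype.card_subtype] at hscore
    have heq := Finset.eq_of_subset_of_card_le hsub hscore.le
    intro j
    simpa using (Finset.ext_iff.mp heq j).symm

lemma wt_eq_permWt_iff {n : ℕ} (π : Equiv.Perm (Fin n)) (M : Finset (P n)) :
    wt M = permWt n π ↔ M = invFinset π := by
  constructor
  · intro hM
    ext ⟨⟨i, j⟩, h⟩
    rw [← beats_iff_mem h, ← beats_iff_mem h, beats_iff_of_wt_eq hM, beats_invFinset]
  · rintro rfl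
    ext i
    simp only [wt_eq_score, beats_invFinset, card_perm_lt, permWt]

lemma card_invFinset {n : ℕ} (π : Equiv.Perm (Fin n)) :
    (invFinset π).card = invCount n π := by
  refine Finset.card_bij (fun p _ => p.1) ?_ ?_ ?_
  · rintro ⟨p, hp⟩ h
    simpa [invFinset, hp] using h
  · intro p _ q _ h
    exact Subtype.ext h
  · intro p hp
    obtain ⟨h, h'⟩ := (Finset.mem_filter.mp hp).2
    exact ⟨⟨p, h⟩, by simpa [invFinset] using h', rfl⟩

lemma isEmpty_Bw_permWt {n : ℕ} (π : Equiv.Perm (Fin n)) {k : ℤ}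
    (hk : k ≠ (invCount n π : ℤ)) : IsEmpty (Bw n k (permWt n π)) := by
  refine ⟨fun ⟨M, hc, hw⟩ => hk ?_⟩
  rw [(wt_eq_permWt_iff π M).mp hw, card_invFinset] at hc
  exact hc.symm

lemma nonempty_equiv_Hw {n : ℕ} {k : ℤ} {w : Fin n → ℤ}
    (hsucc : IsEmpty (Bw n (k + 1) w)) (hpred : IsEmpty (Bw n (k - 1) w)) :
    Nonempty (Hw n k w ≃ₗ[ℤ] Cw n k w) := by
  have hZ : ZW n k w = ⊤ := by
    rw [ZW, Subsingleton.elim (dFromW n k w) 0, LinearMap.ker_zero]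
  have hB : HwSub n k w = ⊥ := by
    rw [HwSub, Subsingleton.elim (dW n k w) 0, LinearMap.range_zero, bot_inf_eq]
    exact LinearMap.ker_eq_bot.mpr (Submodule.injective_subtype _)
  exact ⟨(Submodule.quotEquivOfEqBot _ hB).trans (LinearEquiv.ofTop _ hZ)⟩

/-- For a permutation `π` and `w = (π(1), …, π(n))`, the summand `⟦w⟧` has a single basis
wedge, namely `e_π = ∧_{i<j, π(i)>π(j)} e_{ij}`, in degree `inv(π)`; hence
`H_k⟦w⟧ ≅ ℤ` for `k = inv(π)` and `H_k⟦w⟧ = 0` otherwise. -/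
theorem perm_weight_summand (n : ℕ) (π : Equiv.Perm (Fin n)) :
    (∀ M : Finset (P n), wt M = permWt n π ↔ M = invFinset π) ∧
    (invFinset π).card = invCount n π ∧
    Nonempty (Hw n (invCount n π) (permWt n π) ≃ₗ[ℤ] ℤ) ∧
    (∀ k : ℤ, k ≠ (invCount n π : ℤ) → Subsingleton (Hw n k (permWt n π))) := by
  refine ⟨wt_eq_permWt_iff π, card_invFinset π, ?_, fun k hk => ?_⟩
  · obtain ⟨e⟩ := nonempty_equiv_Hw
      (isEmpty_Bw_permWt π (k := (invCount n π : ℤ) + 1) (by omega))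
      (isEmpty_Bw_permWt π (k := (invCount n π : ℤ) - 1) (by omega))
    have : Subsingleton (Bw n (invCount n π) (permWt n π)) :=
      ⟨fun M N => Subtype.ext <|
        ((wt_eq_permWt_iff π _).mp M.2.2).trans ((wt_eq_permWt_iff π _).mp N.2.2).symm⟩
    exact ⟨e.trans (Finsupp.uniqueLinearEquiv ℤ ℤ
      ⟨invFinset π, by rw [card_invFinset], (wt_eq_permWt_iff π _).mpr rfl⟩)⟩
  · have := isEmpty_Bw_permWt π hk
    exact inferInstanceAs (Subsingleton (ZW n k (permWt n π) ⧸ HwSub n k (permWt n π)))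

end Nil
end
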